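/- With the standing setup, for each 1 ≤ i ≤ m-1 and each w ∈ [u,v]^{(i)}, the permutation w is covered by φ_i(w) = w·(a_i a_{i+1}) in the Bruhat order; in particular ℓ(w·(a_i a_{i+1})) = ℓ(w) + 1. -/

import Mathlib

open Equiv Finset Polynomial

/-- The odd diagram of a permutation of `Fin n` (0-based positions and values):
boxes `(i, j)` with `w i > j`, `i < w⁻¹ j`, and `i`, `w⁻¹ j` of different parity. -/
def oddDiagram {n : ℕ} (w : Equiv.Perm (Fin n)) : Set (Fin n × Fin n) :=
  {p | p.2 < w p.1 ∧ p.1 < w⁻¹ p.2 ∧ ((p.1 : ℕ) % 2 ≠ ((w⁻¹ p.2 : Fin n) : ℕ) % 2)}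

/-- The Bruhat order on `S_n`: the reflexive-transitive closure of the relations
`x < x * (i j)` whenever `i < j` and `x i < x j`. -/
def bruhatLE {n : ℕ} : Equiv.Perm (Fin n) → Equiv.Perm (Fin n) → Prop :=
  Relation.ReflTransGen (fun x y => ∃ i j : Fin n, i < j ∧ x i < x j ∧ y = x * Equiv.swap i j)

/-- Strict Bruhat order. -/
def bruhatLT {n : ℕ} (x y : Equiv.Perm (Fin n)) : Prop := bruhatLE x y ∧ x ≠ y

/-- The Coxeter length of a permutation, i.e. its number of inversions. -/
def invLength {n : ℕ} (w : Equiv.Perm (Fin n)) : ℕ :=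
  (Finset.univ.filter (fun p : Fin n × Fin n => p.1 < p.2 ∧ w p.2 < w p.1)).card

theorem mem_oddDiagram_apply {n : ℕ} (w : Equiv.Perm (Fin n)) (p r : Fin n) :
    (p, w r) ∈ oddDiagram w ↔ w r < w p ∧ p < r ∧ (p : ℕ) % 2 ≠ (r : ℕ) % 2 := by
  simp [oddDiagram]

/-- Apply `swap i j` to both entries of a pair if this keeps the pair increasing. -/
def swapPair {n : ℕ} (i j : Fin n) (p : Fin n × Fin n) : Fin n × Fin n :=
  if Equiv.swap i j p.1 < Equiv.swap i j p.2 then (Equiv.swap i j p.1, Equiv.swap i j p.2) else p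

theorem swapPair_swapPair {n : ℕ} (i j : Fin n) {p : Fin n × Fin n} (hp : p.1 < p.2) :
    swapPair i j (swapPair i j p) = p := by
  unfold swapPair
  split_ifs <;> simp_all

theorem swapPair_mem_inversions {n : ℕ} (x : Equiv.Perm (Fin n)) {i j : Fin n} (hij : i < j)
    (hx : x i < x j) {p : Fin n × Fin n} (hp : p.1 < p.2) (hinv : x p.2 < x p.1) :
    swapPair i j p ≠ (i, j) ∧ (swapPair i j p).1 < (swapPair i j p).2 ∧
      (x * Equiv.swap i j) (swapPair i j p).2 < (x * Equiv.swap i j) (swapPair i j p).1 := by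
  obtain ⟨p, q⟩ := p
  simp only [swapPair, Equiv.Perm.mul_apply] at *
  split_ifs with h
  · refine ⟨?_, h, by simpa using hinv⟩
    grind
  · grind

theorem swapPair_mem_inversions_of_mul_swap {n : ℕ} (x : Equiv.Perm (Fin n)) {i j : Fin n}
    (hij : i < j) (hmid : ∀ c, i < c → c < j → ¬ (x i < x c ∧ x c < x j))
    {p : Fin n × Fin n} (hp : p.1 < p.2) (hne : p ≠ (i, j))
    (hinv : (x * Equiv.swap i j) p.2 < (x * Equiv.swap i j) p.1) :
    (swapPair i j p).1 < (swapPair i j p).2 ∧ x (swapPair i j p).2 < x (swapPair i j p).1 := by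
  obtain ⟨p, q⟩ := p
  have hinj : ∀ c d, x c = x d → c = d := fun c d h => x.injective h
  simp only [swapPair, Equiv.Perm.mul_apply] at *
  split_ifs with h
  · exact ⟨h, hinv⟩
  · refine ⟨hp, ?_⟩
    simp only [Equiv.swap_apply_def] at h hinv
    by_cases hpi : p = i <;> by_cases hpj : p = j <;> by_cases hqi : q = i <;>
      by_cases hqj : q = j <;> simp only [hpi, hpj, hqi, hqj, if_true, if_false] at h hinv <;>
      grind

theorem invLength_lt_mul_swap {n : ℕ} (x : Equiv.Perm (Fin n)) {i j : Fin n} (hij : i < j)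
    (hx : x i < x j) : invLength x < invLength (x * Equiv.swap i j) := by
  have hmem : (i, j) ∈ Finset.univ.filter (fun p : Fin n × Fin n =>
      p.1 < p.2 ∧ (x * Equiv.swap i j) p.2 < (x * Equiv.swap i j) p.1) := by
    exact Finset.mem_filter.2 ⟨Finset.mem_univ _, hij, by simpa using hx⟩
  unfold invLength
  refine lt_of_le_of_lt ?_ (Finset.card_erase_lt_of_mem hmem)
  refine Finset.card_le_card_of_injOn (swapPair i j) ?_ ?_
  · intro p hp
    simp only [Finset.coe_filter, Finset.mem_univ, true_and, Set.mem_ofPred_eq] at hp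
    have := swapPair_mem_inversions x hij hx hp.1 hp.2
    simpa only [Finset.coe_erase, Finset.coe_filter, Finset.mem_univ, true_and, Set.mem_sdiff,
      Set.mem_ofPred_eq, Set.mem_singleton_iff] using ⟨this.2, this.1⟩
  · intro p hp q hq h
    simp only [Finset.coe_filter, Finset.mem_univ, true_and, Set.mem_ofPred_eq] at hp hq
    rw [← swapPair_swapPair i j hp.1, h, swapPair_swapPair i j hq.1]

theorem invLength_mul_swap {n : ℕ} (x : Equiv.Perm (Fin n)) {i j : Fin n} (hij : i < j)
    (hx : x i < x j) (hmid : ∀ c, i < c → c < j → ¬ (x i < x c ∧ x c < x j)) :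
    invLength (x * Equiv.swap i j) = invLength x + 1 := by
  refine le_antisymm ?_ (invLength_lt_mul_swap x hij hx)
  have hmem : (i, j) ∈ Finset.univ.filter (fun p : Fin n × Fin n =>
      p.1 < p.2 ∧ (x * Equiv.swap i j) p.2 < (x * Equiv.swap i j) p.1) := by
    exact Finset.mem_filter.2 ⟨Finset.mem_univ _, hij, by simpa using hx⟩
  unfold invLength
  rw [← Finset.card_erase_add_one hmem]
  refine Nat.add_le_add_right (Finset.card_le_card_of_injOn (swapPair i j) ?_ ?_) 1
  · intro p hp
    simp only [Finset.coe_erase, Finset.coe_filter, Finset.mem_univ, true_and, Set.mem_sdiff,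
      Set.mem_ofPred_eq, Set.mem_singleton_iff] at hp
    simpa only [Finset.coe_filter, Finset.mem_univ, true_and, Set.mem_ofPred_eq] using
      swapPair_mem_inversions_of_mul_swap x hij hmid hp.1.1 hp.2 hp.1.2
  · intro p hp q hq h
    simp only [Finset.coe_erase, Finset.coe_filter, Finset.mem_univ, true_and, Set.mem_sdiff,
      Set.mem_ofPred_eq, Set.mem_singleton_iff] at hp hq
    rw [← swapPair_swapPair i j hp.1.1, h, swapPair_swapPair i j hq.1.1]

theorem invLength_le_of_bruhatLE {n : ℕ} {x y : Equiv.Perm (Fin n)} (h : bruhatLE x y) :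
    invLength x ≤ invLength y := by
  induction h with
  | refl => exact le_rfl
  | tail _ hstep ih =>
    obtain ⟨i, j, hij, hx, rfl⟩ := hstep
    exact ih.trans (invLength_lt_mul_swap _ hij hx).le

theorem invLength_lt_of_bruhatLT {n : ℕ} {x y : Equiv.Perm (Fin n)} (h : bruhatLT x y) :
    invLength x < invLength y := by
  obtain ⟨hle, hne⟩ := h
  rcases Relation.ReflTransGen.cases_head hle with rfl | ⟨z, ⟨i, j, hij, hx, rfl⟩, hz⟩
  · exact absurd rfl hne
  · exact (invLength_lt_mul_swap _ hij hx).trans_le (invLength_le_of_bruhatLE hz)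

/-- The sum of the positions of the values smaller than `t`. -/
def lowPositionSum {n : ℕ} (t : ℕ) (x : Equiv.Perm (Fin n)) : ℕ :=
  ∑ p : Fin n, if (x p : ℕ) < t then (p : ℕ) else 0

theorem lowPositionSum_succ {n : ℕ} (s : Fin n) (x : Equiv.Perm (Fin n)) :
    lowPositionSum ((s : ℕ) + 1) x = lowPositionSum (s : ℕ) x + (x⁻¹ s : Fin n) := by
  have h : ((x⁻¹ s : Fin n) : ℕ) = ∑ p : Fin n, if p = x⁻¹ s then (p : ℕ) else 0 := by simp
  rw [h, lowPositionSum, lowPositionSum, ← Finset.sum_add_distrib]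
  refine Finset.sum_congr rfl fun p _ => ?_
  have hp : p = x⁻¹ s ↔ (x p : ℕ) = s := by
    rw [Equiv.Perm.eq_inv_iff_eq, Fin.ext_iff]
  simp only [hp]
  split_ifs <;> omega

theorem lowPositionSum_le_mul_swap {n : ℕ} (t : ℕ) (x : Equiv.Perm (Fin n)) {i j : Fin n}
    (hij : i < j) (hx : x i < x j) :
    lowPositionSum t x ≤ lowPositionSum t (x * Equiv.swap i j) := by
  have hj : j ∈ Finset.univ.erase i := by simp [hij.ne']
  unfold lowPositionSum
  rw [← Finset.add_sum_erase _ _ (Finset.mem_univ i), ← Finset.add_sum_erase _ _ hj,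
    ← Finset.add_sum_erase (a := i) Finset.univ
      (fun p => if ((x * Equiv.swap i j) p : ℕ) < t then (p : ℕ) else 0) (Finset.mem_univ i),
    ← Finset.add_sum_erase (Finset.univ.erase i)
      (fun p => if ((x * Equiv.swap i j) p : ℕ) < t then (p : ℕ) else 0) hj,
    ← add_assoc, ← add_assoc]
  refine add_le_add ?_ (le_of_eq (Finset.sum_congr rfl fun p hp => ?_))
  · simp only [Equiv.Perm.mul_apply, Equiv.swap_apply_left, Equiv.swap_apply_right]
    rw [Fin.lt_def] at hij hx
    split_ifs <;> omega
  · simp only [Finset.mem_erase, Finset.mem_univ, and_true] at hp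
    rw [Equiv.Perm.mul_apply, Equiv.swap_apply_of_ne_of_ne hp.2 hp.1]

theorem lowPositionSum_le_of_bruhatLE {n : ℕ} (t : ℕ) {x y : Equiv.Perm (Fin n)}
    (h : bruhatLE x y) : lowPositionSum t x ≤ lowPositionSum t y := by
  induction h with
  | refl => exact le_rfl
  | tail _ hstep ih =>
    obtain ⟨i, j, hij, hx, rfl⟩ := hstep
    exact ih.trans (lowPositionSum_le_mul_swap t _ hij hx)

/-- If the endpoints of a Bruhat interval agree on the positions of all values below `k`, then so
does every element of the interval. -/
theorem inv_apply_eq_of_bruhatLE {n : ℕ} {u v w : Equiv.Perm (Fin n)} {k : Fin n}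
    (h : ∀ i : Fin n, i < k → u⁻¹ i = v⁻¹ i) (huw : bruhatLE u w) (hwv : bruhatLE w v)
    {s : Fin n} (hs : s < k) : w⁻¹ s = u⁻¹ s := by
  have key : ∀ t : ℕ, t ≤ k → lowPositionSum t u = lowPositionSum t v := by
    intro t
    induction t with
    | zero => intro _; simp [lowPositionSum]
    | succ t ih =>
      intro ht
      have htn : t < n := by omega
      have hu := lowPositionSum_succ ⟨t, htn⟩ u
      have hv := lowPositionSum_succ ⟨t, htn⟩ v
      rw [h ⟨t, htn⟩ (by rw [Fin.lt_def]; exact ht)] at hu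
      have := ih (by omega)
      simp only at hu hv
      omega
  have hw : ∀ t : ℕ, t ≤ k → lowPositionSum t w = lowPositionSum t u := by
    intro t ht
    have h1 := lowPositionSum_le_of_bruhatLE t huw
    have h2 := lowPositionSum_le_of_bruhatLE t hwv
    have h3 := key t ht
    omega
  rw [Fin.lt_def] at hs
  have h1 := hw s hs.le
  have h2 := hw (s + 1) hs
  rw [lowPositionSum_succ, lowPositionSum_succ] at h2
  apply Fin.ext
  omega

/-- Swapping two positions of equal parity preserves the odd diagram, provided that no position of
the other parity interferes. -/
theorem oddDiagram_mul_swap {n : ℕ} (u : Equiv.Perm (Fin n)) {c b : Fin n} (hcb : c < b)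
    (hu : u b < u c) (hpar : (c : ℕ) % 2 = (b : ℕ) % 2)
    (hmid : ∀ q, c < q → q < b → (q : ℕ) % 2 ≠ (c : ℕ) % 2 → u q < u b)
    (hright : ∀ q, b < q → (q : ℕ) % 2 ≠ (c : ℕ) % 2 → ¬ (u b < u q ∧ u q < u c)) :
    oddDiagram (u * Equiv.swap c b) = oddDiagram u := by
  have hinj : ∀ p q, u p = u q → p = q := fun p q h => u.injective h
  ext ⟨p, y⟩
  obtain ⟨r, rfl⟩ := u.surjective y
  rw [mem_oddDiagram_apply]
  have hr : u r = (u * Equiv.swap c b) (Equiv.swap c b r) := by simp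
  rw [hr, mem_oddDiagram_apply, ← hr, Equiv.Perm.mul_apply]
  simp only [Equiv.swap_apply_def]
  by_cases hpc : p = c <;> by_cases hpb : p = b <;> by_cases hrc : r = c <;>
    by_cases hrb : r = b <;> simp only [hpc, hpb, hrc, hrb, if_true, if_false] <;> grind

/-- With the standing setup, each `w ∈ [u,v]⁽ⁱ⁾` is covered by
`φᵢ(w) = w · (aᵢ aᵢ₊₁)` in the Bruhat order; in particular
`ℓ(w · (aᵢ aᵢ₊₁)) = ℓ(w) + 1`. -/
theorem covered_by_image {n : ℕ} (D : Set (Fin n × Fin n)) (u v : Equiv.Perm (Fin n))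
    (hu : oddDiagram u = D) (hv : oddDiagram v = D) (hne : u ≠ v)
    (hint : ∀ w : Equiv.Perm (Fin n), oddDiagram w = D ↔ (bruhatLE u w ∧ bruhatLE w v))
    (k : Fin n) (hk : u⁻¹ k ≠ v⁻¹ k) (hkmin : ∀ i : Fin n, i < k → u⁻¹ i = v⁻¹ i)
    (m : ℕ) (hm : 0 < m) (aseq : Fin m → Fin n) (hmono : StrictMono aseq)
    (hrange : ∀ i : Fin n, (∃ j : Fin m, aseq j = i) ↔
      (u⁻¹ k ≤ i ∧ i ≤ v⁻¹ k ∧ u (u⁻¹ k) ≤ u i ∧ u i ≤ u (v⁻¹ k))) :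
    ∀ (i : ℕ) (h : i + 1 < m) (w : Equiv.Perm (Fin n)),
      bruhatLE u w → bruhatLE w v → w⁻¹ k = aseq ⟨i, Nat.lt_of_succ_lt h⟩ →
      (bruhatLT w
        (w * Equiv.swap (aseq ⟨i, Nat.lt_of_succ_lt h⟩) (aseq ⟨i + 1, h⟩)) ∧
       ¬ (∃ z : Equiv.Perm (Fin n), bruhatLT w z ∧
          bruhatLT z (w * Equiv.swap (aseq ⟨i, Nat.lt_of_succ_lt h⟩) (aseq ⟨i + 1, h⟩))) ∧
       invLength (w * Equiv.swap (aseq ⟨i, Nat.lt_of_succ_lt h⟩) (aseq ⟨i + 1, h⟩)) =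
         invLength w + 1) := by
  intro i h w huw hwv hwk
  set p := aseq ⟨i, Nat.lt_of_succ_lt h⟩ with hp
  set q := aseq ⟨i + 1, h⟩ with hq
  obtain ⟨a, ha⟩ : ∃ a, a = u⁻¹ k := ⟨_, rfl⟩
  obtain ⟨b, hb⟩ : ∃ b, b = v⁻¹ k := ⟨_, rfl⟩
  rw [← ha, ← hb] at hk
  simp only [← ha, ← hb] at hrange
  have hua : u a = k := by simp [ha]
  have hvb : v b = k := by simp [hb]
  have hwp : w p = k := by simp [← hwk]
  have hwD : oddDiagram w = D := (hint w).2 ⟨huw, hwv⟩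
  have hpq : p < q := hmono (by simp)
  obtain ⟨hap, -, -, -⟩ := (hrange p).1 ⟨_, rfl⟩
  obtain ⟨haq, hqb, hukq, huqb⟩ := (hrange q).1 ⟨_, rfl⟩
  rw [hua] at hukq
  have huv : bruhatLE u v := huw.trans hwv
  -- the values below `k` occupy the same positions in `u`, `w` and `v`
  have hlow : ∀ x : Equiv.Perm (Fin n), bruhatLE u x → bruhatLE x v → ∀ c,
      (x c < k ↔ u c < k) ∧ (u c < k → x c = u c) := by
    intro x hux hxv c
    have h1 : u c < k → x c = u c := fun hc => by
      have := inv_apply_eq_of_bruhatLE hkmin hux hxv hc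
      rw [Equiv.Perm.inv_eq_iff_eq] at this
      simpa using this.symm
    refine ⟨⟨fun hc => ?_, fun hc => (h1 hc).symm ▸ hc⟩, h1⟩
    have := inv_apply_eq_of_bruhatLE hkmin hux hxv hc
    rw [Equiv.Perm.eq_inv_iff_eq] at this
    have hcu : u c = x c := by simpa using this
    exact hcu ▸ hc
  have hab : a < b := (hap.trans_lt hpq).trans_le hqb
  have hcol : ∀ c, a ≤ c → c < b → (c : ℕ) % 2 ≠ (b : ℕ) % 2 → u c < k := by
    intro c hac hcb hpar
    rw [← (hlow v huv .refl c).1]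
    by_contra hc
    have hvc : v b < v c := by
      rw [hvb]
      refine lt_of_le_of_ne (not_lt.1 hc) fun e => hcb.ne ?_
      exact v.injective (e.symm.trans hvb.symm)
    have hmem := (mem_oddDiagram_apply v c b).2 ⟨hvc, hcb, hpar⟩
    rw [hv, ← hu, hvb, ← hua, mem_oddDiagram_apply] at hmem
    exact absurd hmem.2.1 (not_lt.2 hac)
  have hparab : (a : ℕ) % 2 = (b : ℕ) % 2 := by
    by_contra hpar
    exact absurd (hcol a le_rfl hab hpar) (by simp [hua])
  have hwq : k < w q := by
    refine lt_of_le_of_ne (not_lt.1 ?_) fun e => hpq.ne (w.injective (hwp.trans e))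
    rw [(hlow w huw hwv q).1]
    exact not_lt.2 hukq
  have hkub : k ≤ u b := hukq.trans huqb
  have hmid : ∀ c, p < c → c < q → ¬ (w p < w c ∧ w c < w q) := by
    rintro c hpc hcq ⟨hpc', hcq'⟩
    have hac : a ≤ c := hap.trans hpc.le
    have hcb : c < b := hcq.trans_le hqb
    rw [hwp] at hpc'
    have huc : k ≤ u c := by
      rw [← not_lt, ← (hlow w huw hwv c).1]
      exact not_lt.2 hpc'.le
    have hparc : (c : ℕ) % 2 = (b : ℕ) % 2 := by
      by_contra hpar
      exact absurd (hcol c hac hcb hpar) (not_lt.2 huc)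
    have hucb : u b < u c := by
      by_contra hcon
      obtain ⟨l, hl⟩ := (hrange c).2 ⟨hac, hcb.le, hua.symm ▸ huc, not_lt.1 hcon⟩
      rw [← hl, hp, hmono.lt_iff_lt, Fin.lt_def] at hpc
      rw [← hl, hq, hmono.lt_iff_lt, Fin.lt_def] at hcq
      simp only at hpc hcq
      omega
    -- otherwise `u * swap c b` would be an element of the class strictly below `u`
    obtain ⟨r, hbr, hparr, hbr', hrc'⟩ :
        ∃ r, b < r ∧ (r : ℕ) % 2 ≠ (c : ℕ) % 2 ∧ u b < u r ∧ u r < u c := by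
      by_contra! hcon
      have hz : oddDiagram (u * Equiv.swap c b) = D := by
        rw [oddDiagram_mul_swap u hcb hucb hparc, hu]
        · intro r hcr hrb hpar
          exact (hcol r (hac.trans hcr.le) hrb (hparc ▸ hpar)).trans_le hkub
        · rintro r hbr hpar ⟨h1, h2⟩
          exact absurd h2 (not_lt.2 (hcon r hbr hpar h1))
      have h1 := invLength_le_of_bruhatLE ((hint _).1 hz).1
      have h2 := invLength_lt_mul_swap (u * Equiv.swap c b) hcb (by simpa using hucb)
      rw [mul_assoc, Equiv.swap_mul_self, mul_one] at h2
      omega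
    obtain ⟨s, hs⟩ := w.surjective (u r)
    have hcr : (c, w s) ∈ oddDiagram w := by
      rw [hs, hwD, ← hu, mem_oddDiagram_apply]
      exact ⟨hrc', hcb.trans hbr, hparr.symm⟩
    rw [mem_oddDiagram_apply] at hcr
    obtain ⟨hsc, hcs, hpars⟩ := hcr
    have hks : k < w s := hs ▸ hkub.trans_lt hbr'
    have hbs : b < s := by
      by_contra hcon
      have hsb : s < b := lt_of_le_of_ne (not_lt.1 hcon) fun e => hpars (by rw [e, hparc])
      have := hcol s (hac.trans hcs.le) hsb (by rw [← hparc]; exact hpars.symm)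
      rw [← (hlow w huw hwv s).1] at this
      exact absurd this (not_lt.2 hks.le)
    have hparq : (q : ℕ) % 2 = (b : ℕ) % 2 := by
      by_contra hpar
      rcases hqb.lt_or_eq with hlt | heq
      · exact absurd (hcol q haq hlt hpar) (not_lt.2 hukq)
      · exact hpar (by rw [heq])
    have hqs : (q, w s) ∈ oddDiagram w :=
      (mem_oddDiagram_apply w q s).2
        ⟨hsc.trans hcq', hqb.trans_lt hbs, by rw [hparq, ← hparc]; exact hpars⟩
    rw [hs, hwD, ← hu, mem_oddDiagram_apply] at hqs
    exact absurd hqs.1 (not_lt.2 (huqb.trans hbr'.le))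
  have hlt : w p < w q := hwp ▸ hwq
  have hlen := invLength_mul_swap w hpq hlt hmid
  refine ⟨⟨.single ⟨p, q, hpq, hlt, rfl⟩, fun e => ?_⟩, ?_, hlen⟩
  · rw [← e] at hlen
    omega
  · rintro ⟨z, hwz, hzw⟩
    have h1 := invLength_lt_of_bruhatLT hwz
    have h2 := invLength_lt_of_bruhatLT hzw
    omega
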